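/- Assume that for all i = 1,…,n one has min(κ_i(u_{i+1}−u_i), κ_{i−1}(u_i−u_{i−1})) + 2d_i ≥ 0. Then there exists exactly one tuple of real numbers ξ₁ < ξ₂ < ⋯ < ξ_n satisfying the Stefan system: for each i = 1,…,n, d_i ξ_i/2 + k_i(u_{i+1}−u_i) F'(ξ_i/a_i)/(a_i (F(ξ_{i+1}/a_i) − F(ξ_i/a_i))) − k_{i−1}(u_i−u_{i−1}) F'(ξ_i/a_{i−1})/(a_{i−1} (F(ξ_i/a_{i−1}) − F(ξ_{i−1}/a_{i−1}))) = 0, where ξ₀ = −∞ and ξ_{n+1} = +∞. (Equivalently, the increasing self-similar solution of the multi-phase Stefan–Riemann problem exists and is unique.) -/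

import Mathlib

open Real Filter Finset

/-- The rescaled Gaussian cumulative distribution function
`F(ξ) = (1/(2√π)) ∫_{-∞}^{ξ} e^{-s²/4} ds`. -/
noncomputable def F (x : ℝ) : ℝ :=
  (1 / (2 * Real.sqrt Real.pi)) * ∫ s in Set.Iio x, Real.exp (-s ^ 2 / 4)

/-- The derivative `F'(ξ) = (1/(2√π)) e^{-ξ²/4}`. -/
noncomputable def F' (x : ℝ) : ℝ :=
  (1 / (2 * Real.sqrt Real.pi)) * Real.exp (-x ^ 2 / 4)

/-- The functional
`E(ξ̄) = −Σ_{i=0}^{n} k_i(u_{i+1}−u_i) ln(F(ξ_{i+1}/a_i) − F(ξ_i/a_i)) + Σ_{i=1}^{n} d_i ξ_i²/4`,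
with the conventions `ξ₀ = −∞`, `ξ_{n+1} = +∞`, i.e. `F(ξ₀/a₀) = 0`, `F(ξ_{n+1}/a_n) = 1`.
Here `ξ : ℕ → ℝ`, only the values `ξ 1, …, ξ n` being relevant. -/
noncomputable def E (n : ℕ) (u a k d : ℕ → ℝ) (ξ : ℕ → ℝ) : ℝ :=
  -(∑ i ∈ Finset.range (n + 1), k i * (u (i + 1) - u i) *
      Real.log ((if i = n then 1 else F (ξ (i + 1) / a i)) -
        (if i = 0 then 0 else F (ξ i / a i))))
  + ∑ i ∈ Finset.Icc 1 n, d i * ξ i ^ 2 / 4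

/-- Reindexing of a point of `ℝⁿ` as the sequence `ξ_1, …, ξ_n` (paper indexing). -/
noncomputable def toSeq (n : ℕ) (x : EuclideanSpace ℝ (Fin n)) : ℕ → ℝ :=
  fun i => if h : i - 1 < n then x ⟨i - 1, h⟩ else 0

/-- The left-hand side of the `i`-th equation (`1 ≤ i ≤ n`) of the Stefan system:
`d_i ξ_i/2 + k_i(u_{i+1}−u_i) F'(ξ_i/a_i)/(a_i (F(ξ_{i+1}/a_i) − F(ξ_i/a_i)))
 − k_{i−1}(u_i−u_{i−1}) F'(ξ_i/a_{i−1})/(a_{i−1} (F(ξ_i/a_{i−1}) − F(ξ_{i−1}/a_{i−1})))`,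
with the conventions `ξ₀ = −∞` (so `F(ξ₀/a₀) = 0`) and `ξ_{n+1} = +∞` (so `F(ξ_{n+1}/a_n) = 1`). -/
noncomputable def stefanLHS (n : ℕ) (u a k d : ℕ → ℝ) (ξ : ℕ → ℝ) (i : ℕ) : ℝ :=
  d i * ξ i / 2
  + k i * (u (i + 1) - u i) * F' (ξ i / a i) /
      (a i * ((if i = n then 1 else F (ξ (i + 1) / a i)) - F (ξ i / a i)))
  - k (i - 1) * (u i - u (i - 1)) * F' (ξ i / a (i - 1)) /
      (a (i - 1) * (F (ξ i / a (i - 1)) - (if i = 1 then 0 else F (ξ (i - 1) / a (i - 1)))))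

theorem setIntegral_pos_of_forall_pos {f : ℝ → ℝ} {S : Set ℝ} (hS : MeasurableSet S)
    (hpos : 0 < MeasureTheory.volume S) (hf : MeasureTheory.IntegrableOn f S) (h : ∀ s ∈ S, 0 < f s) :
    0 < ∫ s in S, f s := by
  rw [MeasureTheory.setIntegral_pos_iff_support_of_nonneg_ae
    ((MeasureTheory.ae_restrict_iff' hS).2 (MeasureTheory.ae_of_all _ fun s hs => (h s hs).le)) hf]
  have hsupp : S ⊆ Function.support f := fun s hs => (h s hs).ne'
  rwa [Set.inter_eq_right.2 hsupp]

theorem integrable_exp_neg_sq_div_four :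
    MeasureTheory.Integrable fun s : ℝ => Real.exp (-s ^ 2 / 4) := by
  convert integrable_exp_neg_mul_sq (b := 1 / 4) (by norm_num) using 3
  ring

/-- The tilted Gaussian weight, which satisfies `e^{-(x+s)²/4} = e^{-x²/4} * tiltedWeight x s`. -/
noncomputable def tiltedWeight (x s : ℝ) : ℝ := Real.exp (-x * s / 2 - s ^ 2 / 4)

theorem tiltedWeight_pos (x s : ℝ) : 0 < tiltedWeight x s := Real.exp_pos _

theorem tiltedWeight_le_one {x s : ℝ} (hx : 0 ≤ x) (hs : 0 ≤ s) : tiltedWeight x s ≤ 1 := by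
  rw [tiltedWeight, Real.exp_le_one_iff]
  nlinarith [mul_nonneg hx hs, sq_nonneg s]

theorem tiltedWeight_add (x h s : ℝ) :
    tiltedWeight (x + h) s = Real.exp (-(h / 2) * s) * tiltedWeight x s := by
  rw [tiltedWeight, tiltedWeight, ← Real.exp_add]
  ring_nf

theorem exp_neg_sq_add (x s : ℝ) :
    Real.exp (-(x + s) ^ 2 / 4) = Real.exp (-x ^ 2 / 4) * tiltedWeight x s := by
  rw [tiltedWeight, ← Real.exp_add]
  ring_nf

theorem integrable_tiltedWeight (x : ℝ) : MeasureTheory.Integrable (tiltedWeight x) := by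
  have h := (integrable_exp_neg_sq_div_four.comp_add_left x).const_mul (Real.exp (x ^ 2 / 4))
  refine h.congr (MeasureTheory.ae_of_all _ fun s => ?_)
  simp only [exp_neg_sq_add, ← mul_assoc, ← Real.exp_add]
  rw [show x ^ 2 / 4 + -x ^ 2 / 4 = 0 by ring, Real.exp_zero, one_mul]

/-- The mass of `S` under the tilted Gaussian weight. -/
noncomputable def tiltedMass (S : Set ℝ) (x : ℝ) : ℝ := ∫ s in S, tiltedWeight x s

theorem tiltedMass_pos {S : Set ℝ} (hS : MeasurableSet S) (hpos : 0 < MeasureTheory.volume S)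
    (x : ℝ) : 0 < tiltedMass S x :=
  setIntegral_pos_of_forall_pos hS hpos (integrable_tiltedWeight x).integrableOn
    fun s _ => tiltedWeight_pos x s

theorem tiltedMass_strictAnti {S : Set ℝ} (hS : MeasurableSet S)
    (hpos : 0 < MeasureTheory.volume S) (hsub : S ⊆ Set.Ioi 0) : StrictAnti (tiltedMass S) := by
  intro x y hxy
  rw [← sub_pos, tiltedMass, tiltedMass, ← MeasureTheory.integral_sub
    (integrable_tiltedWeight x).integrableOn (integrable_tiltedWeight y).integrableOn]
  refine setIntegral_pos_of_forall_pos hS hpos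
    ((integrable_tiltedWeight x).sub (integrable_tiltedWeight y)).integrableOn fun s hs => ?_
  have hs0 : 0 < s := hsub hs
  rw [sub_pos, tiltedWeight, tiltedWeight, Real.exp_lt_exp]
  nlinarith [mul_pos hs0 (sub_pos.2 hxy)]

theorem tiltedMass_le_two_div {S : Set ℝ} (hS : MeasurableSet S) (hsub : S ⊆ Set.Ioi 0)
    {x : ℝ} (hx : 0 < x) : tiltedMass S x ≤ 2 / x := by
  have hneg : -(x / 2) < 0 := by linarith
  have hint := integrableOn_exp_mul_Ioi hneg 0
  calc tiltedMass S x ≤ ∫ s in S, Real.exp (-(x / 2) * s) := by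
        refine MeasureTheory.setIntegral_mono_on (integrable_tiltedWeight x).integrableOn
          (hint.mono_set hsub) hS fun s _ => ?_
        rw [tiltedWeight, Real.exp_le_exp]
        nlinarith [sq_nonneg s]
    _ ≤ ∫ s in Set.Ioi 0, Real.exp (-(x / 2) * s) :=
        MeasureTheory.setIntegral_mono_set hint
          (MeasureTheory.ae_of_all _ fun s => (Real.exp_pos _).le) hsub.eventuallyLE
    _ = 2 / x := by
        rw [integral_exp_mul_Ioi hneg]
        simp [div_eq_mul_inv]

theorem tiltedMass_add_le {S : Set ℝ} (hS : MeasurableSet S) (hsub : S ⊆ Set.Ioi 0)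
    {x h : ℝ} (hx : 0 ≤ x) (hh : 0 < h) :
    tiltedMass S (x + h) ≤ 2 / h * (1 - Real.exp (-(h / 2) * tiltedMass S x)) := by
  set m := tiltedMass S x with hm
  have hm0 : 0 ≤ m := MeasureTheory.integral_nonneg fun s => (tiltedWeight_pos x s).le
  set κ := Real.exp (-(h / 2) * m) with hκ
  have hanti : ∀ s t : ℝ, s ≤ t → Real.exp (-(h / 2) * t) ≤ Real.exp (-(h / 2) * s) := by
    intro s t hst
    rw [Real.exp_le_exp]
    nlinarith
  have hcont : Continuous fun s : ℝ => Real.exp (-(h / 2) * s) - κ := by fun_prop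
  have hI1 : MeasureTheory.Integrable fun s => tiltedWeight (x + h) s - κ * tiltedWeight x s :=
    (integrable_tiltedWeight _).sub ((integrable_tiltedWeight _).const_mul κ)
  have hI2 : MeasureTheory.IntegrableOn (fun s : ℝ => Real.exp (-(h / 2) * s) - κ)
      (Set.Ioc 0 m) :=
    (intervalIntegrable_iff_integrableOn_Ioc_of_le hm0).1 (hcont.intervalIntegrable _ _)
  have key : ∫ s in S, (tiltedWeight (x + h) s - κ * tiltedWeight x s) ≤
      ∫ s in Set.Ioc 0 m, (Real.exp (-(h / 2) * s) - κ) := by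
    rw [← MeasureTheory.integral_indicator hS,
      ← MeasureTheory.integral_indicator measurableSet_Ioc]
    refine MeasureTheory.integral_mono (hI1.indicator hS)
      ((MeasureTheory.integrable_indicator_iff measurableSet_Ioc).2 hI2) fun s => ?_
    have hfac : tiltedWeight (x + h) s - κ * tiltedWeight x s =
        (Real.exp (-(h / 2) * s) - κ) * tiltedWeight x s := by
      rw [tiltedWeight_add, sub_mul]
    by_cases h1 : s ∈ S <;> by_cases h2 : s ∈ Set.Ioc 0 m
    · rw [Set.indicator_of_mem h1, Set.indicator_of_mem h2, hfac]
      exact mul_le_of_le_one_right (sub_nonneg.2 (hanti s m h2.2))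
        (tiltedWeight_le_one hx h2.1.le)
    · rw [Set.indicator_of_mem h1, Set.indicator_of_notMem h2, hfac]
      have hs0 : 0 < s := hsub h1
      have hms : m ≤ s := le_of_lt (not_le.1 fun hle => h2 ⟨hs0, hle⟩)
      exact mul_nonpos_of_nonpos_of_nonneg (sub_nonpos.2 (hanti m s hms))
        (tiltedWeight_pos x s).le
    · rw [Set.indicator_of_notMem h1, Set.indicator_of_mem h2]
      exact sub_nonneg.2 (hanti s m h2.2)
    · rw [Set.indicator_of_notMem h1, Set.indicator_of_notMem h2]
  have hl : ∫ s in S, (tiltedWeight (x + h) s - κ * tiltedWeight x s) =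
      tiltedMass S (x + h) - κ * m := by
    rw [MeasureTheory.integral_sub (integrable_tiltedWeight _).integrableOn
      ((integrable_tiltedWeight _).const_mul κ).integrableOn, MeasureTheory.integral_const_mul]
    rfl
  have hr : ∫ s in Set.Ioc 0 m, (Real.exp (-(h / 2) * s) - κ) =
      2 / h * (1 - κ) - κ * m := by
    rw [← intervalIntegral.integral_of_le hm0]
    have hderiv : ∀ s ∈ Set.uIcc 0 m, HasDerivAt
        (fun s : ℝ => -(2 / h) * Real.exp (-(h / 2) * s) - κ * s)
        (Real.exp (-(h / 2) * s) - κ) s := by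
      intro s _
      have h1 := (((hasDerivAt_id' s).const_mul (-(h / 2))).exp.const_mul (-(2 / h))).sub
        ((hasDerivAt_id' s).const_mul κ)
      refine h1.congr_deriv ?_
      field_simp
    rw [intervalIntegral.integral_eq_sub_of_hasDerivAt hderiv (hcont.intervalIntegrable _ _)]
    simp only [mul_zero, Real.exp_zero, ← hκ]
    ring
  rw [hl, hr] at key
  linarith

theorem two_sub_le_two_add_mul_exp_neg {z : ℝ} (hz : 0 ≤ z) :
    2 - z ≤ (2 + z) * Real.exp (-z) := by
  have hmono : MonotoneOn (fun z : ℝ => (2 + z) * Real.exp (-z) - (2 - z)) (Set.Ici 0) := by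
    refine monotoneOn_of_deriv_nonneg (convex_Ici 0) (by fun_prop) (by fun_prop) fun y hy => ?_
    have hd : HasDerivAt (fun z : ℝ => (2 + z) * Real.exp (-z) - (2 - z))
        (1 - (1 + y) * Real.exp (-y)) y := by
      have h1 := (((hasDerivAt_id' y).const_add 2).mul (hasDerivAt_neg' y).exp).sub
        ((hasDerivAt_id' y).const_sub 2)
      refine h1.congr_deriv ?_
      ring
    rw [hd.deriv, sub_nonneg]
    calc (1 + y) * Real.exp (-y) ≤ Real.exp y * Real.exp (-y) := by
          gcongr
          linarith [Real.add_one_le_exp y]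
      _ = 1 := by rw [← Real.exp_add, add_neg_cancel, Real.exp_zero]
  have h0 := hmono Set.self_mem_Ici hz hz
  simp only [neg_zero, Real.exp_zero] at h0
  linarith

theorem inv_tiltedMass_sub_ge {S : Set ℝ} (hS : MeasurableSet S)
    (hpos : 0 < MeasureTheory.volume S) (hsub : S ⊆ Set.Ioi 0)
    {x y : ℝ} (hx : 0 ≤ x) (hxy : x ≤ y) :
    (y - x) / 4 ≤ (tiltedMass S y)⁻¹ - (tiltedMass S x)⁻¹ := by
  rcases hxy.eq_or_lt with rfl | hlt
  · simp
  obtain ⟨h, rfl⟩ : ∃ h, y = x + h := ⟨y - x, by ring⟩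
  have hh : 0 < h := by linarith
  have hm := tiltedMass_pos hS hpos x
  have hm' := tiltedMass_pos hS hpos (x + h)
  have hle := tiltedMass_add_le hS hsub hx hh
  set m := tiltedMass S x
  set m' := tiltedMass S (x + h)
  have hexp := two_sub_le_two_add_mul_exp_neg (z := h / 2 * m) (by positivity)
  rw [← neg_mul] at hexp
  have hm'_le : m' * (4 + h * m) ≤ 4 * m := by
    calc m' * (4 + h * m)
        ≤ 2 / h * (1 - Real.exp (-(h / 2) * m)) * (4 + h * m) := by gcongr
      _ = 4 / h * ((2 + h / 2 * m) * (1 - Real.exp (-(h / 2) * m))) := by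
          field_simp
          ring
      _ ≤ 4 / h * (h * m) := by
          refine mul_le_mul_of_nonneg_left ?_ (by positivity)
          linarith
      _ = 4 * m := by field_simp
  rw [inv_eq_one_div, inv_eq_one_div, div_sub_div _ _ hm'.ne' hm.ne',
    div_le_div_iff₀ (by norm_num) (mul_pos hm' hm)]
  linarith

theorem F'_pos (x : ℝ) : 0 < F' x := by
  unfold F'
  positivity

theorem normalization_mul_integral :
    (1 / (2 * Real.sqrt Real.pi)) * ∫ s : ℝ, Real.exp (-s ^ 2 / 4) = 1 := by
  have h := integral_gaussian (1 / 4)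
  have h4 : Real.sqrt (Real.pi / (1 / 4)) = 2 * Real.sqrt Real.pi := by
    rw [show Real.pi / (1 / 4) = 2 ^ 2 * Real.pi by ring,
      Real.sqrt_mul (by norm_num), Real.sqrt_sq (by norm_num)]
  have he : ∀ s : ℝ, -s ^ 2 / 4 = -(1 / 4) * s ^ 2 := fun s => by ring
  simp only [he, h, h4]
  have : 0 < Real.sqrt Real.pi := Real.sqrt_pos.2 Real.pi_pos
  field_simp

theorem F_sub_F (x y : ℝ) :
    F y - F x = (1 / (2 * Real.sqrt Real.pi)) * ∫ s in x..y, Real.exp (-s ^ 2 / 4) := by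
  have hi := integrable_exp_neg_sq_div_four
  rw [F, F, ← mul_sub, ← MeasureTheory.integral_Iic_eq_integral_Iio,
    ← MeasureTheory.integral_Iic_eq_integral_Iio,
    intervalIntegral.integral_Iic_sub_Iic hi.integrableOn hi.integrableOn]

theorem hasDerivAt_F (x : ℝ) : HasDerivAt F (F' x) x := by
  have hc : Continuous fun s : ℝ => Real.exp (-s ^ 2 / 4) := by fun_prop
  have h := ((hc.integral_hasStrictDerivAt 0 x).hasDerivAt.const_mul
    (1 / (2 * Real.sqrt Real.pi))).add_const (F 0)
  have hF : F = fun y => (1 / (2 * Real.sqrt Real.pi)) *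
      (∫ s in (0 : ℝ)..y, Real.exp (-s ^ 2 / 4)) + F 0 :=
    funext fun y => sub_eq_iff_eq_add.1 (F_sub_F 0 y)
  rw [hF]
  exact h

theorem continuous_F : Continuous F :=
  continuous_iff_continuousAt.2 fun x => (hasDerivAt_F x).continuousAt

theorem continuous_F' : Continuous F' := by
  unfold F'
  fun_prop

theorem strictMono_F : StrictMono F :=
  strictMono_of_hasDerivAt_pos hasDerivAt_F F'_pos

theorem F_pos (x : ℝ) : 0 < F x := by
  refine lt_of_le_of_lt ?_ (strictMono_F (sub_one_lt x))
  exact mul_nonneg (by positivity) (MeasureTheory.integral_nonneg fun s => (Real.exp_pos _).le)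

theorem one_sub_F (x : ℝ) :
    1 - F x = (1 / (2 * Real.sqrt Real.pi)) * ∫ s in Set.Ioi x, Real.exp (-s ^ 2 / 4) := by
  have hi := integrable_exp_neg_sq_div_four
  have h := intervalIntegral.integral_Iic_add_Ioi (hi.integrableOn (s := Set.Iic x))
    (hi.integrableOn (s := Set.Ioi x))
  have h1 := normalization_mul_integral
  rw [← h, mul_add, MeasureTheory.integral_Iic_eq_integral_Iio] at h1
  exact sub_eq_iff_eq_add'.2 h1.symm

theorem F_lt_one (x : ℝ) : F x < 1 := by
  refine lt_of_lt_of_le (strictMono_F (lt_add_one x)) (sub_nonneg.1 ?_)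
  rw [one_sub_F]
  exact mul_nonneg (by positivity) (MeasureTheory.integral_nonneg fun s => (Real.exp_pos _).le)

theorem F'_mul_tiltedMass_add (x : ℝ) (U : Set ℝ) :
    F' x * tiltedMass ((fun s => x + s) ⁻¹' U) x =
      (1 / (2 * Real.sqrt Real.pi)) * ∫ s in U, Real.exp (-s ^ 2 / 4) := by
  rw [← (MeasureTheory.measurePreserving_add_left MeasureTheory.volume x).setIntegral_preimage_emb
    (measurableEmbedding_addLeft x)]
  simp only [exp_neg_sq_add]
  rw [MeasureTheory.integral_const_mul, F', tiltedMass]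
  ring

theorem F'_mul_tiltedMass_sub (x : ℝ) (U : Set ℝ) :
    F' x * tiltedMass ((fun s => x - s) ⁻¹' U) (-x) =
      (1 / (2 * Real.sqrt Real.pi)) * ∫ s in U, Real.exp (-s ^ 2 / 4) := by
  rw [← (MeasureTheory.Measure.measurePreserving_sub_left
    MeasureTheory.volume x).setIntegral_preimage_emb (measurableEmbedding_subLeft x)]
  have h : ∀ s : ℝ, Real.exp (-(x - s) ^ 2 / 4) = Real.exp (-x ^ 2 / 4) * tiltedWeight (-x) s := by
    intro s
    rw [← neg_sq x, ← exp_neg_sq_add]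
    ring_nf
  simp only [h]
  rw [MeasureTheory.integral_const_mul, F', tiltedMass]
  ring

theorem F'_div_F_sub_left {x y : ℝ} (hxy : x < y) :
    F' x / (F y - F x) = (tiltedMass (Set.Ioo 0 (y - x)) x)⁻¹ := by
  have h := F'_mul_tiltedMass_add x (Set.Ioo x y)
  rw [← MeasureTheory.integral_Ioc_eq_integral_Ioo, ← intervalIntegral.integral_of_le hxy.le,
    ← F_sub_F, Set.preimage_const_add_Ioo, sub_self] at h
  rw [← h, div_mul_eq_div_div, div_self (F'_pos x).ne', one_div]

theorem F'_div_F_sub_right {x y : ℝ} (hxy : x < y) :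
    F' y / (F y - F x) = (tiltedMass (Set.Ioo 0 (y - x)) (-y))⁻¹ := by
  have h := F'_mul_tiltedMass_sub y (Set.Ioo x y)
  rw [← MeasureTheory.integral_Ioc_eq_integral_Ioo, ← intervalIntegral.integral_of_le hxy.le,
    ← F_sub_F, Set.preimage_const_sub_Ioo, sub_self] at h
  rw [← h, div_mul_eq_div_div, div_self (F'_pos y).ne', one_div]

theorem F'_div_one_sub_F (x : ℝ) :
    F' x / (1 - F x) = (tiltedMass (Set.Ioi 0) x)⁻¹ := by
  have h := F'_mul_tiltedMass_add x (Set.Ioi x)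
  rw [← one_sub_F, Set.preimage_const_add_Ioi, sub_self] at h
  rw [← h, div_mul_eq_div_div, div_self (F'_pos x).ne', one_div]

theorem F'_div_F (x : ℝ) :
    F' x / F x = (tiltedMass (Set.Ioi 0) (-x))⁻¹ := by
  have h := F'_mul_tiltedMass_sub x (Set.Iio x)
  rw [Set.preimage_const_sub_Iio, sub_self] at h
  have hF : F x = F' x * tiltedMass (Set.Ioi 0) (-x) := h.symm
  rw [hF]
  rw [div_mul_eq_div_div, div_self (F'_pos x).ne', one_div]

/-- The interface flux balance at position `z`, written through the tilted masses of the rescaled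
phases `R` (to the right) and `L` (to the left). -/
noncomputable def fluxBalance (A a : ℝ) (R : Set ℝ) (B b : ℝ) (L : Set ℝ) (d z : ℝ) : ℝ :=
  d * z / 2 + A * (tiltedMass R (z / a))⁻¹ - B * (tiltedMass L (-(z / b)))⁻¹

/-- The sets that occur as rescaled phases: measurable, non-null and contained in `(0, ∞)`. -/
def IsPhase (S : Set ℝ) : Prop :=
  MeasurableSet S ∧ 0 < MeasureTheory.volume S ∧ S ⊆ Set.Ioi 0

theorem fluxBalance_neg (A a : ℝ) (R : Set ℝ) (B b : ℝ) (L : Set ℝ) (d z : ℝ) :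
    fluxBalance A a R B b L d (-z) = -fluxBalance B b L A a R d z := by
  simp only [fluxBalance, neg_div, neg_neg]
  ring

theorem fluxBalance_strictMonoOn_Ici {A a B b d : ℝ} {R L : Set ℝ} (hA : 0 < A) (ha : 0 < a)
    (hB : 0 < B) (hb : 0 < b) (hR : IsPhase R) (hL : IsPhase L) (hd : 0 ≤ A / a + 2 * d) :
    StrictMonoOn (fluxBalance A a R B b L d) (Set.Ici 0) := by
  intro x hx y _ hxy
  have hx0 : 0 ≤ x / a := div_nonneg hx ha.le
  have h1 := mul_le_mul_of_nonneg_left (inv_tiltedMass_sub_ge hR.1 hR.2.1 hR.2.2 hx0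
    (div_le_div_of_nonneg_right hxy.le ha.le)) hA.le
  have h2 : (tiltedMass L (-(y / b)))⁻¹ < (tiltedMass L (-(x / b)))⁻¹ :=
    inv_strictAnti₀ (tiltedMass_pos hL.1 hL.2.1 _) (tiltedMass_strictAnti hL.1 hL.2.1 hL.2.2
      (neg_lt_neg (div_lt_div_of_pos_right hxy hb)))
  have h3 := mul_lt_mul_of_pos_left h2 hB
  have h4 : A * ((y / a - x / a) / 4) = A / a * (y - x) / 4 := by ring
  have h5 := mul_nonneg hd (sub_pos.2 hxy).le
  simp only [fluxBalance]
  linarith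

theorem fluxBalance_strictMono {A a B b d : ℝ} {R L : Set ℝ} (hA : 0 < A) (ha : 0 < a)
    (hB : 0 < B) (hb : 0 < b) (hR : IsPhase R) (hL : IsPhase L)
    (hd : 0 ≤ min (A / a) (B / b) + 2 * d) :
    StrictMono (fluxBalance A a R B b L d) := by
  refine StrictMonoOn.Iic_union_Ici (a := 0) ?_ (fluxBalance_strictMonoOn_Ici hA ha hB hb hR hL
    (hd.trans (by gcongr; exact min_le_left _ _)))
  intro x hx y hy hxy
  have h := fluxBalance_strictMonoOn_Ici hB hb hA ha hL hR
    (hd.trans (by gcongr; exact min_le_right _ _))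
    (Set.mem_Ici.2 (neg_nonneg.2 hy)) (Set.mem_Ici.2 (neg_nonneg.2 hx)) (neg_lt_neg hxy)
  simpa only [fluxBalance_neg, neg_lt_neg_iff] using h

theorem exists_fluxBalance_nonpos {A a B b d : ℝ} {R L : Set ℝ} (hA : 0 < A) (ha : 0 < a)
    (hB : 0 < B) (hb : 0 < b) (hR : IsPhase R) (hL : IsPhase L)
    (hd : 0 ≤ B / b + 2 * d) :
    ∃ C, ∀ z ≤ C, fluxBalance A a R B b L d z ≤ 0 := by
  set K := A * (tiltedMass R 0)⁻¹
  have hBb : 0 < B / b := div_pos hB hb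
  have hK : 0 < K := mul_pos hA (inv_pos.2 (tiltedMass_pos hR.1 hR.2.1 0))
  refine ⟨-(4 * K / (B / b)), fun z hz => ?_⟩
  have hz0 : z < 0 := hz.trans_lt (neg_lt_zero.2 (by positivity))
  have hz1 : 4 * K ≤ -z * (B / b) := (div_le_iff₀ hBb).1 (by linarith)
  have h1 : A * (tiltedMass R (z / a))⁻¹ ≤ K := by
    refine mul_le_mul_of_nonneg_left (inv_anti₀ (tiltedMass_pos hR.1 hR.2.1 0) ?_) hA.le
    exact (tiltedMass_strictAnti hR.1 hR.2.1 hR.2.2).antitone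
      (div_nonpos_of_nonpos_of_nonneg hz0.le ha.le)
  have hpos : 0 < -(z / b) := neg_pos.2 (div_neg_of_neg_of_pos hz0 hb)
  have h2 : B * (-(z / b) / 2) ≤ B * (tiltedMass L (-(z / b)))⁻¹ := by
    refine mul_le_mul_of_nonneg_left ?_ hB.le
    rw [← inv_div]
    exact inv_anti₀ (tiltedMass_pos hL.1 hL.2.1 _) (tiltedMass_le_two_div hL.1 hL.2.2 hpos)
  have h3 : B * (-(z / b) / 2) = -z * (B / b) / 2 := by ring
  have h4 := mul_nonneg hd (neg_pos.2 hz0).le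
  simp only [fluxBalance]
  linarith

theorem exists_fluxBalance_nonneg {A a B b d : ℝ} {R L : Set ℝ} (hA : 0 < A) (ha : 0 < a)
    (hB : 0 < B) (hb : 0 < b) (hR : IsPhase R) (hL : IsPhase L)
    (hd : 0 ≤ A / a + 2 * d) :
    ∃ C, ∀ z, C ≤ z → 0 ≤ fluxBalance A a R B b L d z := by
  obtain ⟨C, hC⟩ := exists_fluxBalance_nonpos hB hb hA ha hL hR hd
  refine ⟨-C, fun z hz => ?_⟩
  have h := hC (-z) (by linarith)
  rw [fluxBalance_neg] at h
  linarith

theorem tiltedMass_mono {S T : Set ℝ} (h : S ⊆ T) (x : ℝ) : tiltedMass S x ≤ tiltedMass T x :=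
  MeasureTheory.setIntegral_mono_set (integrable_tiltedWeight x).integrableOn
    (MeasureTheory.ae_of_all _ fun s => (tiltedWeight_pos x s).le) h.eventuallyLE

theorem fluxBalance_le_of_subset {A a B b d z : ℝ} {R R' L L' : Set ℝ} (hA : 0 < A) (hB : 0 < B)
    (hR : IsPhase R) (hL' : IsPhase L') (hRR : R ⊆ R') (hLL : L' ⊆ L) :
    fluxBalance A a R' B b L' d z ≤ fluxBalance A a R B b L d z := by
  have h1 := mul_le_mul_of_nonneg_left (inv_anti₀ (tiltedMass_pos hR.1 hR.2.1 (z / a))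
    (tiltedMass_mono hRR _)) hA.le
  have h2 := mul_le_mul_of_nonneg_left (inv_anti₀ (tiltedMass_pos hL'.1 hL'.2.1 (-(z / b)))
    (tiltedMass_mono hLL _)) hB.le
  simp only [fluxBalance]
  linarith

/-- The tuple `ξ 1, …, ξ n` is strictly increasing. -/
def IncreasingUpTo (n : ℕ) (ξ : ℕ → ℝ) : Prop := ∀ i, 1 ≤ i → i < n → ξ i < ξ (i + 1)

/-- The `j`-th phase between the free boundaries `ξ j` and `ξ (j + 1)`, shifted to start at `0`
and rescaled by `a j`; the extreme phases are unbounded. -/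
noncomputable def phase (n : ℕ) (a ξ : ℕ → ℝ) (j : ℕ) : Set ℝ :=
  if j = 0 ∨ j = n then Set.Ioi 0 else Set.Ioo 0 (ξ (j + 1) / a j - ξ j / a j)

theorem isPhase_phase {n : ℕ} {a ξ : ℕ → ℝ} (ha : ∀ i ≤ n, 0 < a i) (hξ : IncreasingUpTo n ξ)
    {j : ℕ} (hj : j ≤ n) : IsPhase (phase n a ξ j) := by
  unfold phase
  split_ifs with h
  · exact ⟨measurableSet_Ioi, by simp, subset_rfl⟩
  · rw [not_or] at h
    have := div_lt_div_of_pos_right (hξ j (by lia) (by lia)) (ha j hj)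
    exact ⟨measurableSet_Ioo, by simpa using this, fun s hs => hs.1⟩

theorem phase_subset {n : ℕ} {a ξ η : ℕ → ℝ} (ha : ∀ i ≤ n, 0 < a i) {j : ℕ} (hj : j ≤ n)
    (h : 1 ≤ j → j < n → ξ (j + 1) - ξ j ≤ η (j + 1) - η j) :
    phase n a ξ j ⊆ phase n a η j := by
  unfold phase
  split_ifs with h0
  · exact subset_rfl
  · rw [not_or] at h0
    refine Set.Ioo_subset_Ioo_right ?_
    rw [← sub_div, ← sub_div]
    exact div_le_div_of_nonneg_right (h (by lia) (by lia)) (ha j hj).le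

theorem phase_const_add (n : ℕ) (a ξ : ℕ → ℝ) (t : ℝ) (j : ℕ) :
    phase n a (fun i => t + ξ i) j = phase n a ξ j := by
  simp only [phase, ← sub_div, add_sub_add_left_eq_sub]

theorem stefanLHS_succ_eq {n : ℕ} {u a k d ξ : ℕ → ℝ} (hξ : IncreasingUpTo n ξ)
    (ha : ∀ i ≤ n, 0 < a i) {j : ℕ} (hj : j < n) :
    stefanLHS n u a k d ξ (j + 1) =
      fluxBalance (k (j + 1) * (u (j + 2) - u (j + 1)) / a (j + 1)) (a (j + 1))
        (phase n a ξ (j + 1)) (k j * (u (j + 1) - u j) / a j) (a j) (phase n a ξ j)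
        (d (j + 1)) (ξ (j + 1)) := by
  have hR : F' (ξ (j + 1) / a (j + 1)) / ((if j + 1 = n then 1 else F (ξ (j + 2) / a (j + 1))) -
      F (ξ (j + 1) / a (j + 1))) =
      (tiltedMass (phase n a ξ (j + 1)) (ξ (j + 1) / a (j + 1)))⁻¹ := by
    by_cases h : j + 1 = n
    · simp only [phase, h, if_true, or_true]
      exact F'_div_one_sub_F _
    · simp only [phase, h, if_false, or_false, Nat.succ_ne_zero]
      exact F'_div_F_sub_left
        (div_lt_div_of_pos_right (hξ (j + 1) (by lia) (by lia)) (ha (j + 1) hj))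
  have hL : F' (ξ (j + 1) / a j) / (F (ξ (j + 1) / a j) -
      (if j + 1 = 1 then 0 else F (ξ j / a j))) =
      (tiltedMass (phase n a ξ j) (-(ξ (j + 1) / a j)))⁻¹ := by
    by_cases h : j = 0
    · simp only [phase, h, zero_add, if_true, true_or, sub_zero]
      exact F'_div_F _
    · simp only [phase, h, hj.ne, if_false, or_false, Nat.add_eq_right]
      exact F'_div_F_sub_right (div_lt_div_of_pos_right (hξ j (by lia) hj) (ha j hj.le))
  rw [fluxBalance, ← hR, ← hL]
  simp only [stefanLHS, Nat.add_sub_cancel, mul_div_mul_comm]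

theorem stefanLHS_le_of_neighbors_le {n : ℕ} {u a k d ξ ζ : ℕ → ℝ}
    (hu : ∀ i ≤ n, u i < u (i + 1)) (ha : ∀ i ≤ n, 0 < a i) (hk : ∀ i ≤ n, 0 < k i)
    (hξ : IncreasingUpTo n ξ) (hζ : IncreasingUpTo n ζ) {i : ℕ} (hi : 1 ≤ i) (hin : i ≤ n)
    (hle : ∀ j, 1 ≤ j → j ≤ n → ξ j ≤ ζ j) (heq : ξ i = ζ i) :
    stefanLHS n u a k d ζ i ≤ stefanLHS n u a k d ξ i := by
  obtain ⟨j, rfl⟩ : ∃ j, i = j + 1 := ⟨i - 1, by lia⟩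
  rw [stefanLHS_succ_eq hξ ha hin, stefanLHS_succ_eq hζ ha hin, heq]
  have hw : ∀ m ≤ n, 0 < k m * (u (m + 1) - u m) / a m := fun m hm =>
    div_pos (mul_pos (hk m hm) (sub_pos.2 (hu m hm))) (ha m hm)
  refine fluxBalance_le_of_subset (hw _ hin) (hw _ (by lia)) (isPhase_phase ha hξ hin)
    (isPhase_phase ha hζ (by lia)) (phase_subset ha hin fun h1 h2 => ?_)
    (phase_subset ha (by lia) fun h1 h2 => ?_)
  · linarith [hle (j + 1 + 1) (by lia) (by lia)]
  · linarith [hle j h1 (by lia)]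

theorem stefanLHS_const_add_lt {n : ℕ} {u a k d ξ : ℕ → ℝ}
    (hu : ∀ i ≤ n, u i < u (i + 1)) (ha : ∀ i ≤ n, 0 < a i) (hk : ∀ i ≤ n, 0 < k i)
    (hconv : ∀ i, 1 ≤ i → i ≤ n →
      0 ≤ min (k i / a i ^ 2 * (u (i + 1) - u i))
            (k (i - 1) / a (i - 1) ^ 2 * (u i - u (i - 1))) + 2 * d i)
    (hξ : IncreasingUpTo n ξ) {i : ℕ} (hi : 1 ≤ i) (hin : i ≤ n) {t : ℝ} (ht : 0 < t) :
    stefanLHS n u a k d ξ i < stefanLHS n u a k d (fun j => t + ξ j) i := by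
  obtain ⟨j, rfl⟩ : ∃ j, i = j + 1 := ⟨i - 1, by lia⟩
  have hξt : IncreasingUpTo n fun j => t + ξ j := fun i h1 h2 => by linarith [hξ i h1 h2]
  have hw : ∀ m ≤ n, 0 < k m * (u (m + 1) - u m) / a m := fun m hm =>
    div_pos (mul_pos (hk m hm) (sub_pos.2 (hu m hm))) (ha m hm)
  rw [stefanLHS_succ_eq hξ ha hin, stefanLHS_succ_eq hξt ha hin, phase_const_add, phase_const_add]
  refine fluxBalance_strictMono (hw _ hin) (ha _ hin) (hw j (by lia)) (ha j (by lia))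
    (isPhase_phase ha hξ hin) (isPhase_phase ha hξ (by lia)) ?_ (by linarith)
  convert hconv (j + 1) hi hin using 3
  · rw [div_div, ← pow_two, mul_div_right_comm]
  · rw [div_div, ← pow_two, mul_div_right_comm, Nat.add_sub_cancel]

theorem le_of_stefanLHS_nonpos_of_nonneg {n : ℕ} {u a k d ξ η : ℕ → ℝ}
    (hu : ∀ i ≤ n, u i < u (i + 1)) (ha : ∀ i ≤ n, 0 < a i) (hk : ∀ i ≤ n, 0 < k i)
    (hconv : ∀ i, 1 ≤ i → i ≤ n →
      0 ≤ min (k i / a i ^ 2 * (u (i + 1) - u i))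
            (k (i - 1) / a (i - 1) ^ 2 * (u i - u (i - 1))) + 2 * d i)
    (hξ : IncreasingUpTo n ξ) (hξ0 : ∀ i, 1 ≤ i → i ≤ n → stefanLHS n u a k d ξ i ≤ 0)
    (hη : IncreasingUpTo n η) (hη0 : ∀ i, 1 ≤ i → i ≤ n → 0 ≤ stefanLHS n u a k d η i)
    {i : ℕ} (hi : 1 ≤ i) (hin : i ≤ n) : ξ i ≤ η i := by
  obtain ⟨m, hm, hmax⟩ := (Finset.Icc 1 n).exists_max_image (fun j => ξ j - η j)
    ⟨i, Finset.mem_Icc.2 ⟨hi, hin⟩⟩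
  rw [Finset.mem_Icc] at hm
  by_contra! hlt
  have ht : 0 < ξ m - η m := (sub_pos.2 hlt).trans_le (hmax i (Finset.mem_Icc.2 ⟨hi, hin⟩))
  have h1 := stefanLHS_const_add_lt hu ha hk hconv hη hm.1 hm.2 ht
  have h2 := stefanLHS_le_of_neighbors_le (u := u) (k := k) (d := d) hu ha hk hξ
    (ζ := fun j => ξ m - η m + η j) (fun i h1 h2 => by linarith [hη i h1 h2]) hm.1 hm.2
    (fun j hj hjn => by linarith [hmax j (Finset.mem_Icc.2 ⟨hj, hjn⟩)]) (by ring)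
  linarith [hξ0 m hm.1 hm.2, hη0 m hm.1 hm.2]

theorem exists_stefanLHS_nonpos {n : ℕ} {u a k d : ℕ → ℝ}
    (hu : ∀ i ≤ n, u i < u (i + 1)) (ha : ∀ i ≤ n, 0 < a i) (hk : ∀ i ≤ n, 0 < k i)
    (hconv : ∀ i, 1 ≤ i → i ≤ n → 0 ≤ k (i - 1) / a (i - 1) ^ 2 * (u i - u (i - 1)) + 2 * d i) :
    ∃ ξ, IncreasingUpTo n ξ ∧ ∀ i, 1 ≤ i → i ≤ n → stefanLHS n u a k d ξ i ≤ 0 := by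
  have hcast : IncreasingUpTo n fun i => (i : ℝ) := fun i _ _ => by simp
  have hw : ∀ m ≤ n, 0 < k m * (u (m + 1) - u m) / a m := fun m hm =>
    div_pos (mul_pos (hk m hm) (sub_pos.2 (hu m hm))) (ha m hm)
  have hC : ∀ j, ∃ C, j < n → ∀ z ≤ C,
      fluxBalance (k (j + 1) * (u (j + 2) - u (j + 1)) / a (j + 1)) (a (j + 1))
        (phase n a (fun i => (i : ℝ)) (j + 1)) (k j * (u (j + 1) - u j) / a j) (a j)
        (phase n a (fun i => (i : ℝ)) j) (d (j + 1)) z ≤ 0 := by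
    intro j
    by_cases hj : j < n
    · obtain ⟨C, hC⟩ := exists_fluxBalance_nonpos (d := d (j + 1)) (hw (j + 1) hj) (ha _ hj)
        (hw j hj.le) (ha _ hj.le) (isPhase_phase ha hcast hj) (isPhase_phase ha hcast hj.le) (by
          have h := hconv (j + 1) (by lia) hj
          rwa [Nat.add_sub_cancel, ← mul_div_right_comm, pow_two, ← div_div] at h)
      exact ⟨C, fun _ => hC⟩
    · exact ⟨0, fun h => absurd h hj⟩
  choose C hC using hC
  obtain ⟨t, ht⟩ := ((Finset.range n).image fun j => (j + 1 : ℕ) - C j).exists_le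
  have hinc : IncreasingUpTo n fun i => -t + (i : ℝ) := fun i _ _ => by simp
  refine ⟨fun i => -t + i, hinc, fun i hi hin => ?_⟩
  obtain ⟨j, rfl⟩ : ∃ j, i = j + 1 := ⟨i - 1, by lia⟩
  rw [stefanLHS_succ_eq hinc ha hin, phase_const_add, phase_const_add]
  refine hC j hin _ ?_
  linarith [ht _ (Finset.mem_image_of_mem _ (Finset.mem_range.2 hin))]

theorem exists_stefanLHS_nonneg {n : ℕ} {u a k d : ℕ → ℝ}
    (hu : ∀ i ≤ n, u i < u (i + 1)) (ha : ∀ i ≤ n, 0 < a i) (hk : ∀ i ≤ n, 0 < k i)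
    (hconv : ∀ i, 1 ≤ i → i ≤ n → 0 ≤ k i / a i ^ 2 * (u (i + 1) - u i) + 2 * d i) :
    ∃ ξ, IncreasingUpTo n ξ ∧ ∀ i, 1 ≤ i → i ≤ n → 0 ≤ stefanLHS n u a k d ξ i := by
  have hcast : IncreasingUpTo n fun i => (i : ℝ) := fun i _ _ => by simp
  have hw : ∀ m ≤ n, 0 < k m * (u (m + 1) - u m) / a m := fun m hm =>
    div_pos (mul_pos (hk m hm) (sub_pos.2 (hu m hm))) (ha m hm)
  have hC : ∀ j, ∃ C, j < n → ∀ z, C ≤ z →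
      0 ≤ fluxBalance (k (j + 1) * (u (j + 2) - u (j + 1)) / a (j + 1)) (a (j + 1))
        (phase n a (fun i => (i : ℝ)) (j + 1)) (k j * (u (j + 1) - u j) / a j) (a j)
        (phase n a (fun i => (i : ℝ)) j) (d (j + 1)) z := by
    intro j
    by_cases hj : j < n
    · obtain ⟨C, hC⟩ := exists_fluxBalance_nonneg (d := d (j + 1)) (hw (j + 1) hj) (ha _ hj)
        (hw j hj.le) (ha _ hj.le) (isPhase_phase ha hcast hj) (isPhase_phase ha hcast hj.le) (by
          have h := hconv (j + 1) (by lia) hj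
          rwa [← mul_div_right_comm, pow_two, ← div_div] at h)
      exact ⟨C, fun _ => hC⟩
    · exact ⟨0, fun h => absurd h hj⟩
  choose C hC using hC
  obtain ⟨t, ht⟩ := ((Finset.range n).image fun j => C j - (j + 1 : ℕ)).exists_le
  have hinc : IncreasingUpTo n fun i => t + (i : ℝ) := fun i _ _ => by simp
  refine ⟨fun i => t + i, hinc, fun i hi hin => ?_⟩
  obtain ⟨j, rfl⟩ : ∃ j, i = j + 1 := ⟨i - 1, by lia⟩
  rw [stefanLHS_succ_eq hinc ha hin, phase_const_add, phase_const_add]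
  refine hC j hin _ ?_
  linarith [ht _ (Finset.mem_image_of_mem _ (Finset.mem_range.2 hin))]

theorem right_denominator_pos {n : ℕ} {a ξ : ℕ → ℝ} (ha : ∀ i ≤ n, 0 < a i)
    (hξ : IncreasingUpTo n ξ) {i : ℕ} (hi : 1 ≤ i) (hin : i ≤ n) :
    0 < (if i = n then 1 else F (ξ (i + 1) / a i)) - F (ξ i / a i) := by
  split_ifs with h
  · exact sub_pos.2 (F_lt_one _)
  · exact sub_pos.2 (strictMono_F (div_lt_div_of_pos_right (hξ i hi (by lia)) (ha i hin)))

theorem left_denominator_pos {n : ℕ} {a ξ : ℕ → ℝ} (ha : ∀ i ≤ n, 0 < a i)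
    (hξ : IncreasingUpTo n ξ) {i : ℕ} (hi : 1 ≤ i) (hin : i ≤ n) :
    0 < F (ξ i / a (i - 1)) - (if i = 1 then 0 else F (ξ (i - 1) / a (i - 1))) := by
  split_ifs with h
  · exact sub_pos.2 (F_pos _)
  · have h1 := hξ (i - 1) (by lia) (by lia)
    rw [Nat.sub_add_cancel hi] at h1
    exact sub_pos.2 (strictMono_F (div_lt_div_of_pos_right h1 (ha _ (by lia))))

theorem continuousAt_stefanLHS_update {n : ℕ} {u a k d ξ : ℕ → ℝ} (ha : ∀ i ≤ n, 0 < a i)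
    (hξ : IncreasingUpTo n ξ) {i : ℕ} (hi : 1 ≤ i) (hin : i ≤ n) :
    ContinuousAt (fun z => stefanLHS n u a k d (Function.update ξ i z) i) (ξ i) := by
  have h1 : i + 1 ≠ i := by lia
  have h2 : i - 1 ≠ i := by lia
  have hF := continuous_F
  have hF' := continuous_F'
  simp only [stefanLHS, Function.update_self, Function.update_of_ne h1, Function.update_of_ne h2]
  refine ContinuousAt.sub (ContinuousAt.add (by fun_prop) (ContinuousAt.div (by fun_prop)
    (by fun_prop) ?_)) (ContinuousAt.div (by fun_prop) (by fun_prop) ?_)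
  · exact (mul_pos (ha i hin) (right_denominator_pos ha hξ hi hin)).ne'
  · exact (mul_pos (ha _ (by lia)) (left_denominator_pos ha hξ hi hin)).ne'

theorem F'_le_F'_zero (x : ℝ) : F' x ≤ F' 0 := by
  refine mul_le_mul_of_nonneg_left (Real.exp_le_exp.2 ?_) (by positivity)
  nlinarith [sq_nonneg x]

theorem F_sub_F_le {x y : ℝ} (hxy : x < y) : F y - F x ≤ F' 0 * (y - x) := by
  obtain ⟨c, _, hc⟩ := exists_hasDerivAt_eq_slope F F' hxy continuous_F.continuousOn
    fun z _ => hasDerivAt_F z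
  rw [← (eq_div_iff (sub_pos.2 hxy).ne').1 hc]
  exact mul_le_mul_of_nonneg_right (F'_le_F'_zero c) (sub_pos.2 hxy).le

theorem exists_gap_of_left_denominator_ge {n : ℕ} {u a k d : ℕ → ℝ}
    (hu : ∀ i ≤ n, u i < u (i + 1)) (ha : ∀ i ≤ n, 0 < a i) (hk : ∀ i ≤ n, 0 < k i)
    {i : ℕ} (hi : 1 ≤ i) (hin : i < n) {e : ℝ} (he : 0 < e) (lo up : ℝ) :
    ∃ δ > 0, ∀ ξ, IncreasingUpTo n ξ → stefanLHS n u a k d ξ i ≤ 0 → lo ≤ ξ i → ξ i ≤ up →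
      e ≤ F (ξ i / a (i - 1)) - (if i = 1 then 0 else F (ξ (i - 1) / a (i - 1))) →
      ξ i + δ ≤ ξ (i + 1) := by
  rcases lt_or_ge up lo with hlt | hlohi
  · exact ⟨1, one_pos, fun ξ _ _ h1 h2 => absurd (h1.trans h2) (not_le.2 hlt)⟩
  have hai := ha i hin.le
  have hai' := ha (i - 1) (by lia)
  obtain ⟨z₀, _, hz₀⟩ := (isCompact_Icc (a := lo) (b := up)).exists_isMinOn
    (Set.nonempty_Icc.2 hlohi) (f := fun z => F' (z / a i))
    (by have := continuous_F'; fun_prop)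
  set m := F' (z₀ / a i)
  have hm : 0 < m := F'_pos _
  set c := k i * (u (i + 1) - u i) with hc_def
  have hc : 0 < c := mul_pos (hk i hin.le) (sub_pos.2 (hu i hin.le))
  set c' := k (i - 1) * (u i - u (i - 1)) with hc'_def
  have hc' : 0 < c' := by
    have := hu (i - 1) (by lia)
    rw [Nat.sub_add_cancel hi] at this
    exact mul_pos (hk _ (by lia)) (sub_pos.2 this)
  have hF0 := F'_pos 0
  set K := c' * F' 0 / (a (i - 1) * e) + |d i| * (|lo| + |up|) / 2 with hK_def
  have hK : 0 < K := by positivity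
  refine ⟨c * m / (K * F' 0), by positivity, fun ξ hξ hle h1 h2 hden => ?_⟩
  have hgap := hξ i hi hin
  have hR : 0 < F (ξ (i + 1) / a i) - F (ξ i / a i) :=
    sub_pos.2 (strictMono_F (div_lt_div_of_pos_right hgap hai))
  have hL : c' * F' (ξ i / a (i - 1)) / (a (i - 1) * (F (ξ i / a (i - 1)) -
      (if i = 1 then 0 else F (ξ (i - 1) / a (i - 1))))) ≤ c' * F' 0 / (a (i - 1) * e) := by
    gcongr
    exact F'_le_F'_zero _
  have habs : |ξ i| ≤ |lo| + |up| := by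
    rw [abs_le]
    constructor
    · linarith [neg_abs_le lo, abs_nonneg up]
    · linarith [le_abs_self up, abs_nonneg lo]
  have hdξ : -(d i * ξ i) ≤ |d i| * (|lo| + |up|) := by
    calc -(d i * ξ i) ≤ |d i * ξ i| := neg_le_abs _
      _ = |d i| * |ξ i| := abs_mul _ _
      _ ≤ _ := by gcongr
  have hsum : c * F' (ξ i / a i) / (a i * (F (ξ (i + 1) / a i) - F (ξ i / a i))) ≤ K := by
    rw [stefanLHS, if_neg hin.ne, ← hc_def, ← hc'_def] at hle
    linarith
  rw [div_le_iff₀ (mul_pos hai hR)] at hsum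
  have hlip := F_sub_F_le (div_lt_div_of_pos_right hgap hai)
  have hcm : c * m ≤ (ξ (i + 1) - ξ i) * (K * F' 0) := by
    calc c * m ≤ c * F' (ξ i / a i) := by
          gcongr
          exact hz₀ ⟨h1, h2⟩
      _ ≤ K * (a i * (F' 0 * (ξ (i + 1) / a i - ξ i / a i))) := hsum.trans (by gcongr)
      _ = (ξ (i + 1) - ξ i) * (K * F' 0) := by
          field_simp
  linarith [(div_le_iff₀ (mul_pos hK hF0)).2 hcm]

theorem exists_uniform_gap {n : ℕ} {u a k d : ℕ → ℝ}
    (hu : ∀ i ≤ n, u i < u (i + 1)) (ha : ∀ i ≤ n, 0 < a i) (hk : ∀ i ≤ n, 0 < k i)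
    (lo up : ℕ → ℝ) {i : ℕ} (hi : 1 ≤ i) (hin : i < n) :
    ∃ δ > 0, ∀ ξ, IncreasingUpTo n ξ → (∀ j, 1 ≤ j → j ≤ n → stefanLHS n u a k d ξ j ≤ 0) →
      (∀ j, 1 ≤ j → j ≤ n → lo j ≤ ξ j ∧ ξ j ≤ up j) → ξ i + δ ≤ ξ (i + 1) := by
  induction i, hi using Nat.le_induction with
  | base =>
    obtain ⟨δ, hδ, h⟩ := exists_gap_of_left_denominator_ge (d := d) hu ha hk le_rfl hin
      (F_pos (lo 1 / a 0)) (lo 1) (up 1)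
    refine ⟨δ, hδ, fun ξ hξ hξ0 hb => ?_⟩
    have hb1 := hb 1 le_rfl hin.le
    refine h ξ hξ (hξ0 1 le_rfl hin.le) hb1.1 hb1.2 ?_
    rw [if_pos rfl, sub_zero]
    exact strictMono_F.monotone (div_le_div_of_nonneg_right hb1.1 (ha 0 (by lia)).le)
  | succ i hi ih =>
    obtain ⟨δ', hδ', h'⟩ := ih (by lia)
    have hai := ha i (by lia)
    rcases lt_or_ge (up i) (lo i) with hlt | hlohi
    · refine ⟨1, one_pos, fun ξ _ _ hb => ?_⟩
      have hbi := hb i hi (by lia)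
      exact absurd (hbi.1.trans hbi.2) (not_le.2 hlt)
    obtain ⟨z₀, _, hz₀⟩ := (isCompact_Icc (a := lo i) (b := up i)).exists_isMinOn
      (Set.nonempty_Icc.2 hlohi) (f := fun z => F ((z + δ') / a i) - F (z / a i))
      (by have := continuous_F; fun_prop)
    have he : 0 < F ((z₀ + δ') / a i) - F (z₀ / a i) :=
      sub_pos.2 (strictMono_F (div_lt_div_of_pos_right (by linarith) hai))
    obtain ⟨δ, hδ, h⟩ := exists_gap_of_left_denominator_ge (d := d) hu ha hk
      (i := i + 1) (by lia) hin he (lo (i + 1)) (up (i + 1))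
    refine ⟨δ, hδ, fun ξ hξ hξ0 hb => ?_⟩
    have hb1 := hb (i + 1) (by lia) hin.le
    refine h ξ hξ (hξ0 _ (by lia) hin.le) hb1.1 hb1.2 ?_
    rw [if_neg (by lia), Nat.add_sub_cancel]
    refine (hz₀ (hb i hi (by lia))).trans (sub_le_sub_right ?_ _)
    exact strictMono_F.monotone (div_le_div_of_nonneg_right (h' ξ hξ hξ0 hb) hai.le)

theorem IncreasingUpTo.update {n : ℕ} {ξ : ℕ → ℝ} (hξ : IncreasingUpTo n ξ) {i : ℕ} {z : ℝ}
    (hl : 1 < i → ξ (i - 1) < z) (hr : i < n → z < ξ (i + 1)) :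
    IncreasingUpTo n (Function.update ξ i z) := by
  intro j hj hjn
  rcases eq_or_ne j i with rfl | h1
  · rw [Function.update_self, Function.update_of_ne (by lia)]
    exact hr hjn
  rcases eq_or_ne (j + 1) i with rfl | h2
  · rw [Function.update_self, Function.update_of_ne h1]
    exact hl (by lia)
  · rw [Function.update_of_ne h1, Function.update_of_ne h2]
    exact hξ j hj hjn

theorem IncreasingUpTo.eventually_update {n : ℕ} {ξ : ℕ → ℝ} (hξ : IncreasingUpTo n ξ) {i : ℕ}
    (hi : 1 ≤ i) (hin : i ≤ n) :
    ∀ᶠ z in nhds (ξ i), IncreasingUpTo n (Function.update ξ i z) := by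
  have hl : ∀ᶠ z in nhds (ξ i), 1 < i → ξ (i - 1) < z := by
    refine Filter.eventually_imp_distrib_left.2 fun h => lt_mem_nhds ?_
    have h1 := hξ (i - 1) (by lia) (by lia)
    rwa [Nat.sub_add_cancel hi] at h1
  have hr : ∀ᶠ z in nhds (ξ i), i < n → z < ξ (i + 1) :=
    Filter.eventually_imp_distrib_left.2 fun h => gt_mem_nhds (hξ i hi h)
  filter_upwards [hl, hr] with z h1 h2 using hξ.update h1 h2

/-- Perron's method: the supremum of the subsolutions above a given one solves the system. -/
theorem exists_stefanLHS_eq_zero {n : ℕ} {u a k d : ℕ → ℝ}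
    (hu : ∀ i ≤ n, u i < u (i + 1)) (ha : ∀ i ≤ n, 0 < a i) (hk : ∀ i ≤ n, 0 < k i)
    (hconv : ∀ i, 1 ≤ i → i ≤ n →
      0 ≤ min (k i / a i ^ 2 * (u (i + 1) - u i))
            (k (i - 1) / a (i - 1) ^ 2 * (u i - u (i - 1))) + 2 * d i) :
    ∃ ξ, IncreasingUpTo n ξ ∧ ∀ i, 1 ≤ i → i ≤ n → stefanLHS n u a k d ξ i = 0 := by
  obtain ⟨α, hα, hα0⟩ := exists_stefanLHS_nonpos hu ha hk fun i hi hin =>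
    (hconv i hi hin).trans (by gcongr; exact min_le_right _ _)
  obtain ⟨β, hβ, hβ0⟩ := exists_stefanLHS_nonneg hu ha hk fun i hi hin =>
    (hconv i hi hin).trans (by gcongr; exact min_le_left _ _)
  set S : Set (ℕ → ℝ) := {ξ | IncreasingUpTo n ξ ∧
    (∀ i, 1 ≤ i → i ≤ n → stefanLHS n u a k d ξ i ≤ 0) ∧ ∀ i, 1 ≤ i → i ≤ n → α i ≤ ξ i}
  have hαS : α ∈ S := ⟨hα, hα0, fun _ _ _ => le_rfl⟩
  have hSβ : ∀ ξ ∈ S, ∀ i, 1 ≤ i → i ≤ n → ξ i ≤ β i := fun ξ hξ i hi hin =>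
    le_of_stefanLHS_nonpos_of_nonneg hu ha hk hconv hξ.1 hξ.2.1 hβ hβ0 hi hin
  set x : ℕ → ℝ := fun i => sSup ((fun ξ => ξ i) '' S)
  have hne : ∀ i, ((fun ξ : ℕ → ℝ => ξ i) '' S).Nonempty := fun i => ⟨_, α, hαS, rfl⟩
  have hlub : ∀ i, 1 ≤ i → i ≤ n → IsLUB ((fun ξ : ℕ → ℝ => ξ i) '' S) (x i) := by
    intro i hi hin
    refine isLUB_csSup (hne i) ⟨β i, ?_⟩
    rintro _ ⟨ξ, hξ, rfl⟩
    exact hSβ ξ hξ i hi hin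
  have hSx : ∀ ξ ∈ S, ∀ i, 1 ≤ i → i ≤ n → ξ i ≤ x i := fun ξ hξ i hi hin =>
    (hlub i hi hin).1 ⟨ξ, hξ, rfl⟩
  have hx : IncreasingUpTo n x := by
    intro i hi hin
    obtain ⟨δ, hδ, hgap⟩ := exists_uniform_gap (d := d) hu ha hk α β hi hin
    suffices h : x i ≤ x (i + 1) - δ by linarith
    refine (hlub i hi hin.le).2 ?_
    rintro _ ⟨ξ, hξ, rfl⟩
    have h1 := hgap ξ hξ.1 hξ.2.1 fun j hj hjn => ⟨hξ.2.2 j hj hjn, hSβ ξ hξ j hj hjn⟩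
    have h2 := hSx ξ hξ (i + 1) (by lia) hin
    simp only
    linarith
  have hle : ∀ i, 1 ≤ i → i ≤ n → stefanLHS n u a k d x i ≤ 0 := by
    intro i hi hin
    by_contra! hpos
    have hcont := continuousAt_stefanLHS_update (u := u) (k := k) (d := d) ha hx hi hin
    have hev := (hcont.eventually_const_lt (u := 0) (by simpa using hpos)).and
      (hx.eventually_update hi hin)
    obtain ⟨_, ⟨ξ, hξ, rfl⟩, hξpos, hinc⟩ := (((hlub i hi hin).frequently_mem (hne i)).and_eventually
      (hev.filter_mono nhdsWithin_le_nhds)).exists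
    have h := stefanLHS_le_of_neighbors_le (u := u) (k := k) (d := d) hu ha hk hξ.1 hinc hi hin
      (fun j hj hjn => by
        rcases eq_or_ne j i with rfl | hji
        · simp
        · simpa [hji] using hSx ξ hξ j hj hjn) (by simp)
    exact absurd (hξ.2.1 i hi hin) (not_le.2 (hξpos.trans_le h))
  refine ⟨x, hx, fun i hi hin => (hle i hi hin).antisymm ?_⟩
  by_contra! hneg
  have hcont := continuousAt_stefanLHS_update (u := u) (k := k) (d := d) ha hx hi hin
  have hev := (hcont.eventually_lt_const (u := 0) (by simpa using hneg)).and
    (hx.eventually_update hi hin)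
  obtain ⟨z, ⟨hz0, hinc⟩, hxz⟩ := ((hev.filter_mono nhdsWithin_le_nhds).and
    (self_mem_nhdsWithin (s := Set.Ioi (x i)))).exists
  have hxle : ∀ j, x j ≤ Function.update x i z j := by
    intro j
    rcases eq_or_ne j i with rfl | hji
    · simpa using (Set.mem_Ioi.1 hxz).le
    · simp [hji]
  have hmem : Function.update x i z ∈ S := by
    refine ⟨hinc, fun j hj hjn => ?_, fun j hj hjn => (hSx α hαS j hj hjn).trans (hxle j)⟩
    rcases eq_or_ne j i with rfl | hji
    · exact hz0.le
    · exact (stefanLHS_le_of_neighbors_le hu ha hk hx hinc hj hjn (fun m _ _ => hxle m)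
        (by simp [hji])).trans (hle j hj hjn)
  have h := hSx _ hmem i hi hin
  rw [Function.update_self] at h
  exact absurd hxz (not_lt.2 h)

/-- If `min(κ_i(u_{i+1}−u_i), κ_{i−1}(u_i−u_{i−1})) + 2d_i ≥ 0` for all `i = 1,…,n`, there is
exactly one tuple `ξ₁ < ⋯ < ξ_n` satisfying the Stefan system: the increasing self-similar
solution of the multi-phase Stefan–Riemann problem exists and is unique. -/
theorem stmt17 (n : ℕ) (hn : 1 ≤ n) (u a k d : ℕ → ℝ)
    (hu : ∀ i ≤ n, u i < u (i + 1))
    (ha : ∀ i ≤ n, 0 < a i)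
    (hk : ∀ i ≤ n, 0 < k i)
    (hconv : ∀ i, 1 ≤ i → i ≤ n →
      0 ≤ min (k i / a i ^ 2 * (u (i + 1) - u i))
            (k (i - 1) / a (i - 1) ^ 2 * (u i - u (i - 1))) + 2 * d i) :
    (∃ ξ : ℕ → ℝ, (∀ i, 1 ≤ i → i < n → ξ i < ξ (i + 1)) ∧
        ∀ i, 1 ≤ i → i ≤ n → stefanLHS n u a k d ξ i = 0) ∧
    (∀ ξ η : ℕ → ℝ,
      (∀ i, 1 ≤ i → i < n → ξ i < ξ (i + 1)) →
      (∀ i, 1 ≤ i → i ≤ n → stefanLHS n u a k d ξ i = 0) →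
      (∀ i, 1 ≤ i → i < n → η i < η (i + 1)) →
      (∀ i, 1 ≤ i → i ≤ n → stefanLHS n u a k d η i = 0) →
      ∀ i, 1 ≤ i → i ≤ n → ξ i = η i) := by
  obtain ⟨ξ, hξ, hξ0⟩ := exists_stefanLHS_eq_zero hu ha hk hconv
  refine ⟨⟨ξ, hξ, hξ0⟩, fun ξ η hξ hξ0 hη hη0 i hi hin => le_antisymm ?_ ?_⟩
  · exact le_of_stefanLHS_nonpos_of_nonneg hu ha hk hconv hξ (fun j h1 h2 => (hξ0 j h1 h2).le)
      hη (fun j h1 h2 => (hη0 j h1 h2).ge) hi hin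
  · exact le_of_stefanLHS_nonpos_of_nonneg hu ha hk hconv hη (fun j h1 h2 => (hη0 j h1 h2).le)
      hξ (fun j h1 h2 => (hξ0 j h1 h2).ge) hi hin
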